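/- Let a₁,…,a_k and s₁,…,s_k be Dyck paths with |a_i| = |s_i| and a_i ≤ s_i for every i ∈ [k]. Then V(ua₁d·ua₂d·⋯·ua_kd, us₁d·us₂d·⋯·us_kd) = Π_{i=1}^k V(ua_id, us_id). -/

import Mathlib

/-- A binary path is a list of steps: `true` = upstep `u`, `false` = downstep `d`. -/
abbrev BinPath := List Bool

/-- `ht P k` is the height of the `k`-th point of the path `P` (the point reached
after the first `k` steps). -/
def ht (P : BinPath) (k : ℕ) : ℤ :=
  ((P.take k).map (fun b => if b then (1 : ℤ) else -1)).sum

/-- The lattice order on binary paths of the same length: `P ≤ Q` iff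
`hᵢ(P) ≤ hᵢ(Q)` for all `i`. -/
def pathLe (P Q : BinPath) : Prop :=
  P.length = Q.length ∧ ∀ k, ht P k ≤ ht Q k

def pathLt (P Q : BinPath) : Prop := pathLe P Q ∧ P ≠ Q

/-- The maximum path `1ₙ = uⁿ`. -/
def maxPath (n : ℕ) : BinPath := List.replicate n true

/-- Step `i` (0-based) of `P` is a downstep whose endpoint is a valley, i.e. it is
followed by an upstep or it is the last step of `P`. -/
def isValley (P : BinPath) (i : ℕ) : Prop :=
  i < P.length ∧ P.getD i true = false ∧ P.getD (i + 1) true = true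

/-- The number of valleys of `P`. -/
def numValleys (P : BinPath) : ℕ :=
  ((Finset.range P.length).filter
    (fun i => P.getD i true = false ∧ P.getD (i + 1) true = true)).card

/-- The filling of `P`: every valley of `P` is turned into a peak
(each occurrence `du` whose middle point is a valley becomes `ud`, and a final
valley-`d` becomes `u`). -/
def fill (P : BinPath) : BinPath :=
  List.ofFn (fun i : Fin P.length =>
    if P.get i then P.getD (i.1 - 1) true else P.getD (i.1 + 1) true)

/-- The degree of `P`: the least `k` such that the `k`-fold iterated filling
of `P` is the maximum path. -/
noncomputable def degree (P : BinPath) : ℕ :=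
  sInf {k | fill^[k] P = maxPath P.length}

/-- `fPath P` is the number of chains from `P` to the maximum path `1_{|P|}` of
length `degree P` having small intervals. -/
noncomputable def fPath (P : BinPath) : ℕ :=
  Set.ncard {c : ℕ → BinPath |
    c 0 = P ∧ (∀ i, degree P ≤ i → c i = maxPath P.length) ∧
    ∀ i < degree P, pathLt (c i) (c (i + 1)) ∧ pathLe (c (i + 1)) (fill (c i))}

/-- Height of the lowest valley of `P`. -/
noncomputable def lv (P : BinPath) : ℤ :=
  sInf {h : ℤ | ∃ i, isValley P i ∧ ht P (i + 1) = h}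

/-- Height of the highest valley of `P`. -/
noncomputable def hv (P : BinPath) : ℤ :=
  sSup {h : ℤ | ∃ i, isValley P i ∧ ht P (i + 1) = h}

noncomputable def hvNat (P : BinPath) : ℕ := (hv P).toNat

/-- `P′`: every low valley of `P` is turned into a peak. -/
noncomputable def lowFill (P : BinPath) : BinPath :=
  List.ofFn (fun i : Fin P.length =>
    if P.get i then
      (if P.getD (i.1 - 1) true = false ∧ ht P i.1 = lv P then false else true)
    else
      (if P.getD (i.1 + 1) true = true ∧ ht P (i.1 + 1) = lv P then true else false))

/-- `P*`: every valley of `P` is turned into a peak, except the last one when `P`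
ends with a downstep. -/
def starFill (P : BinPath) : BinPath :=
  List.ofFn (fun i : Fin P.length =>
    if i.1 + 1 = P.length ∧ P.get i = false then false
    else if P.get i then P.getD (i.1 - 1) true else P.getD (i.1 + 1) true)

/-- A Dyck path: starts and ends at height 0 and lies weakly above height 0. -/
def IsDyck (P : BinPath) : Prop := ht P P.length = 0 ∧ ∀ k, 0 ≤ ht P k

/-- A Dyck prefix: a prefix of a Dyck path. -/
def IsDyckPrefix (P : BinPath) : Prop := ∃ Q : BinPath, IsDyck (P ++ Q)

/-- A Dyck suffix: a suffix of a Dyck path. -/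
def IsDyckSuffix (P : BinPath) : Prop := ∃ Q : BinPath, IsDyck (Q ++ P)

/-- The pyramid `u^m d^m`. -/
def pyramid (m : ℕ) : BinPath := List.replicate m true ++ List.replicate m false

/-- Cardinality of the interval `[P, Q]` in the lattice of binary paths. -/
noncomputable def intervalCard (P Q : BinPath) : ℕ :=
  Set.ncard {R : BinPath | pathLe P R ∧ pathLe R Q}

/-- `I(s) = |[s, u^{|s|/2} d^{|s|/2}]|`. -/
noncomputable def Ifun (s : BinPath) : ℕ := intervalCard s (pyramid (s.length / 2))

/-- `J(P) = |[P, u^{|P|}]|`. -/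
noncomputable def Jfun (P : BinPath) : ℕ := intervalCard P (maxPath P.length)

/-- `P` and `Q` have exactly the same valleys at every height at most `m`. -/
def sameValleysUpTo (P Q : BinPath) (m : ℤ) : Prop :=
  ∀ (i : ℕ) (t : ℤ), t ≤ m →
    ((isValley P i ∧ ht P (i + 1) = t) ↔ (isValley Q i ∧ ht Q (i + 1) = t))

/-- A multichain of Dyck paths of type `V` from `a` to `s`: it has length
`h = hv(a)` and for every `j ∈ [h]` its `(j-1)`-st and `j`-th members have the
same valleys at every height at most `h - j`.  (The function `σ` is frozen from
index `h` on, so that such multichains are counted correctly.) -/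
def IsVChain (a s : BinPath) (σ : ℕ → BinPath) : Prop :=
  σ 0 = a ∧ (∀ j, hvNat a ≤ j → σ j = s) ∧ (∀ j, IsDyck (σ j)) ∧
  (∀ j < hvNat a, pathLe (σ j) (σ (j + 1))) ∧
  (∀ j, 1 ≤ j → j ≤ hvNat a →
    sameValleysUpTo (σ (j - 1)) (σ j) ((hvNat a : ℤ) - (j : ℤ)))

/-- `V(a,s)`: the number of `a`–`s` multichains of type `V`. -/
noncomputable def VPath (a s : BinPath) : ℕ :=
  Set.ncard {σ : ℕ → BinPath | IsVChain a s σ}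

/-- `ζ^k(P,Q)`: the number of `P`–`Q` multichains of length `k`. -/
noncomputable def zetaPow (k : ℕ) (P Q : BinPath) : ℕ :=
  Set.ncard {c : ℕ → BinPath |
    c 0 = P ∧ (∀ i, k ≤ i → c i = Q) ∧ ∀ i < k, pathLe (c i) (c (i + 1))}

/-- The join of two paths of the same length (pointwise max of heights). -/
def pathSup (P Q : BinPath) : BinPath :=
  List.ofFn (fun i : Fin P.length =>
    decide (max (ht P i.1) (ht Q i.1) < max (ht P (i.1 + 1)) (ht Q (i.1 + 1))))

/-- The meet of two paths of the same length (pointwise min of heights). -/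
def pathInf (P Q : BinPath) : BinPath :=
  List.ofFn (fun i : Fin P.length =>
    decide (min (ht P i.1) (ht Q i.1) < min (ht P (i.1 + 1)) (ht Q (i.1 + 1))))

/-- `Q` covers `P` in the lattice of binary paths. -/
def pathCovBy (P Q : BinPath) : Prop :=
  pathLt P Q ∧ ∀ R : BinPath, pathLt P R → pathLt R Q → False

/-- `l(P,Q) = (1/2)·Σᵢ (hᵢ(Q) − hᵢ(P))`. -/
def lpq (P Q : BinPath) : ℕ :=
  ((∑ i ∈ Finset.range P.length, (ht Q (i + 1) - ht P (i + 1))) / 2).toNat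

/-- Convolution in the incidence algebra of the lattice of binary paths. -/
noncomputable def conv (F G : BinPath → BinPath → ℤ) : BinPath → BinPath → ℤ :=
  fun P Q => ∑ᶠ (R : BinPath) (_ : pathLe P R ∧ pathLe R Q), F P R * G R Q

/-- The delta function of the incidence algebra. -/
def deltaFun : BinPath → BinPath → ℤ := fun P Q => if P = Q then 1 else 0

/-- `μ^k`: the `k`-th convolution power of `μ` (`μ^0` is the delta function). -/
noncomputable def muPow (mu : BinPath → BinPath → ℤ) (k : ℕ) : BinPath → BinPath → ℤ :=
  (conv mu)^[k] deltaFun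

/-! ### Heights -/

theorem ht_zero (P : BinPath) : ht P 0 = 0 := by simp [ht]

theorem ht_succ (P : BinPath) {k : ℕ} (hk : k < P.length) :
    ht P (k + 1) = ht P k + if P.getD k true then 1 else -1 := by
  rw [ht, ht, List.take_add_one, List.getElem?_eq_getElem hk, List.getD_eq_getElem _ _ hk,
    List.map_append, List.sum_append]
  simp

theorem ht_of_length_le (P : BinPath) {k : ℕ} (hk : P.length ≤ k) :
    ht P k = ht P P.length := by
  simp [ht, List.take_of_length_le hk]

theorem ht_append_left (P Q : BinPath) {k : ℕ} (hk : k ≤ P.length) :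
    ht (P ++ Q) k = ht P k := by
  simp [ht, List.take_append_of_le_length hk]

theorem ht_append_right (P Q : BinPath) (k : ℕ) :
    ht (P ++ Q) (P.length + k) = ht P P.length + ht Q k := by
  rw [ht, List.take_length_add_append]
  simp [ht]

theorem eq_of_ht_eq {P Q : BinPath} (hlen : P.length = Q.length)
    (h : ∀ k, ht P k = ht Q k) : P = Q := by
  refine List.ext_getElem hlen fun k hP hQ => ?_
  have h₁ := ht_succ P hP
  have h₂ := ht_succ Q hQ
  rw [h, h, h₂, List.getD_eq_getElem _ _ hP, List.getD_eq_getElem _ _ hQ] at h₁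
  cases hp : P[k] <;> cases hq : Q[k] <;> first | rfl | simp [hp, hq] at h₁

/-! ### Concatenation of Dyck paths -/

theorem isDyck_nil : IsDyck [] := by simp [IsDyck, ht]

theorem IsDyck.getD_zero {P : BinPath} (hP : IsDyck P) : P.getD 0 true = true := by
  cases P with
  | nil => rfl
  | cons b P =>
    have := hP.2 1
    cases b <;> simp_all [ht]

theorem IsDyck.append {P Q : BinPath} (hP : IsDyck P) (hQ : IsDyck Q) : IsDyck (P ++ Q) := by
  refine ⟨by rw [List.length_append, ht_append_right, hP.1, hQ.1, add_zero], fun k => ?_⟩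
  rcases le_total k P.length with hk | hk
  · rw [ht_append_left _ _ hk]
    exact hP.2 k
  · obtain ⟨i, rfl⟩ := Nat.exists_eq_add_of_le hk
    rw [ht_append_right, hP.1, zero_add]
    exact hQ.2 i

theorem IsDyck.of_append {P Q : BinPath} (h : IsDyck (P ++ Q))
    (h₀ : ht (P ++ Q) P.length = 0) : IsDyck P ∧ IsDyck Q := by
  have hP : ht P P.length = 0 := by rwa [ht_append_left _ _ le_rfl] at h₀
  refine ⟨⟨hP, fun k => ?_⟩, ?_, fun k => ?_⟩
  · rcases le_total k P.length with hk | hk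
    · rw [← ht_append_left P Q hk]
      exact h.2 k
    · rw [ht_of_length_le _ hk, hP]
  · have := h.1
    rwa [List.length_append, ht_append_right, hP, zero_add] at this
  · have := h.2 (P.length + k)
    rwa [ht_append_right, hP, zero_add] at this

theorem IsDyck.elevate {P : BinPath} (hP : IsDyck P) : IsDyck (true :: (P ++ [false])) := by
  have hcons (k : ℕ) : ht (true :: (P ++ [false])) (k + 1) = 1 + ht (P ++ [false]) k := by
    simp [ht]
  refine ⟨?_, fun k => ?_⟩
  · rw [List.length_cons, hcons, List.length_append, ht_append_right, hP.1]
    simp [ht]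
  · cases k with
    | zero => rw [ht_zero]
    | succ k =>
      rw [hcons]
      rcases le_total k P.length with hk | hk
      · rw [ht_append_left _ _ hk]
        have := hP.2 k
        omega
      · obtain ⟨i, rfl⟩ := Nat.exists_eq_add_of_le hk
        rw [ht_append_right, hP.1]
        cases i <;> simp [ht]

theorem pathLe_append_iff {P Q P' Q' : BinPath} (hlen : P.length = P'.length)
    (hP : IsDyck P) (hP' : IsDyck P') :
    pathLe (P ++ Q) (P' ++ Q') ↔ pathLe P P' ∧ pathLe Q Q' := by
  constructor
  · rintro ⟨hl, h⟩
    refine ⟨⟨hlen, fun k => ?_⟩, by simpa [hlen] using hl, fun k => ?_⟩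
    · rcases le_total k P.length with hk | hk
      · have := h k
        rwa [ht_append_left _ _ hk, ht_append_left _ _ (hlen ▸ hk)] at this
      · rw [ht_of_length_le _ hk, hP.1]
        exact hP'.2 k
    · have := h (P.length + k)
      rwa [ht_append_right, hlen, ht_append_right, ← hlen, hP.1, hlen, hP'.1, zero_add,
        zero_add] at this
  · rintro ⟨⟨-, h₁⟩, hl, h₂⟩
    refine ⟨by simp [hlen, hl], fun k => ?_⟩
    rcases le_total k P.length with hk | hk
    · rw [ht_append_left _ _ hk, ht_append_left _ _ (hlen ▸ hk)]
      exact h₁ k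
    · obtain ⟨i, rfl⟩ := Nat.exists_eq_add_of_le hk
      rw [ht_append_right, hP.1, hlen, ht_append_right, hP'.1, zero_add, zero_add]
      exact h₂ i

/-! ### Valleys -/

theorem isValley_append_left {P Q : BinPath} (hQ : IsDyck Q) {i : ℕ} (hi : i < P.length) :
    isValley (P ++ Q) i ↔ isValley P i := by
  have hnext : (P ++ Q).getD (i + 1) true = P.getD (i + 1) true := by
    rcases Nat.lt_or_ge (i + 1) P.length with h | h
    · exact List.getD_append _ _ _ _ h
    · rw [List.getD_append_right _ _ _ _ h, List.getD_eq_default _ _ h,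
        show i + 1 - P.length = 0 by omega, hQ.getD_zero]
  rw [isValley, isValley, hnext, List.getD_append _ _ _ _ hi, List.length_append]
  simp [hi, Nat.lt_add_right _ hi]

theorem isValley_append_right (P Q : BinPath) (i : ℕ) :
    isValley (P ++ Q) (P.length + i) ↔ isValley Q i := by
  rw [isValley, isValley, List.getD_append_right _ _ _ _ (Nat.le_add_right _ _),
    List.getD_append_right _ _ _ _ (by omega), List.length_append]
  simp [Nat.add_assoc]

theorem sameValleysUpTo_append_iff {P Q P' Q' : BinPath} (hlen : P.length = P'.length)
    (hP : IsDyck P) (hQ : IsDyck Q) (hP' : IsDyck P') (hQ' : IsDyck Q') (m : ℤ) :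
    sameValleysUpTo (P ++ Q) (P' ++ Q') m ↔
      sameValleysUpTo P P' m ∧ sameValleysUpTo Q Q' m := by
  have left (R : BinPath) {S : BinPath} (hS : IsDyck S) {i : ℕ} (hi : i < R.length) (t : ℤ) :
      (isValley (R ++ S) i ∧ ht (R ++ S) (i + 1) = t) ↔ (isValley R i ∧ ht R (i + 1) = t) := by
    rw [isValley_append_left hS hi, ht_append_left _ _ hi]
  have right {R : BinPath} (S : BinPath) (hR : IsDyck R) (i : ℕ) (t : ℤ) :
      (isValley (R ++ S) (R.length + i) ∧ ht (R ++ S) (R.length + i + 1) = t) ↔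
        (isValley S i ∧ ht S (i + 1) = t) := by
    rw [isValley_append_right, add_assoc, ht_append_right, hR.1, zero_add]
  constructor
  · refine fun h => ⟨fun i t ht => ?_, fun i t ht => ?_⟩
    · by_cases hi : i < P.length
      · rw [← left P hQ hi, ← left P' hQ' (hlen ▸ hi)]
        exact h i t ht
      · exact ⟨fun hv => absurd hv.1.1 hi, fun hv => absurd (hlen ▸ hv.1.1) hi⟩
    · rw [← right Q hP, ← right Q' hP', ← hlen]
      exact h _ t ht
  · rintro ⟨h₁, h₂⟩ i t ht
    rcases Nat.lt_or_ge i P.length with hi | hi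
    · rw [left P hQ hi, left P' hQ' (hlen ▸ hi)]
      exact h₁ i t ht
    · obtain ⟨i, rfl⟩ := Nat.exists_eq_add_of_le hi
      rw [right Q hP, hlen, right Q' hP']
      exact h₂ i t ht

/-- A path lying weakly above `P` and passing through all valleys of `P` equals `P`. -/
theorem pathLe.eq_of_ht_valley_eq {P Q : BinPath} (hle : pathLe P Q)
    (h : ∀ i, isValley P i → ht Q (i + 1) = ht P (i + 1)) : P = Q := by
  have down : ∀ n k, P.length - k ≤ n → k < P.length → P.getD k true = false →
      ht Q (k + 1) ≤ ht P (k + 1) := by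
    intro n
    induction n with
    | zero => intro k hn hk; omega
    | succ n ih =>
      intro k hn hk hd
      cases hd' : P.getD (k + 1) true with
      | true => exact (h k ⟨hk, hd, hd'⟩).le
      | false =>
        have hk' : k + 1 < P.length := by
          by_contra hlt
          rw [List.getD_eq_default _ _ (not_lt.1 hlt)] at hd'
          cases hd'
        have h₁ := ih (k + 1) (by omega) hk' hd'
        have h₂ := ht_succ P hk'
        have h₃ := ht_succ Q (k := k + 1) (hle.1 ▸ hk')
        rw [hd'] at h₂
        split_ifs at h₂ h₃ <;> simp_all; omega
  refine eq_of_ht_eq hle.1 fun k => le_antisymm (hle.2 k) ?_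
  induction k with
  | zero => rw [ht_zero, ht_zero]
  | succ k ih =>
    rcases Nat.lt_or_ge k P.length with hk | hk
    · cases hd : P.getD k true with
      | false => exact down _ k le_rfl hk hd
      | true =>
        have h₁ := ht_succ P hk
        have h₂ := ht_succ Q (k := k) (hle.1 ▸ hk)
        rw [hd] at h₁
        split_ifs at h₁ h₂ <;> simp_all; omega
    · rw [ht_of_length_le P (by omega : P.length ≤ k + 1), ← ht_of_length_le P hk,
        ht_of_length_le Q (hle.1 ▸ (by omega) : Q.length ≤ k + 1),
        ← ht_of_length_le Q (hle.1 ▸ hk : Q.length ≤ k)]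
      exact ih

theorem ht_le_hvNat {P : BinPath} {i : ℕ} (hi : isValley P i) : ht P (i + 1) ≤ hvNat P := by
  have hfin : {h : ℤ | ∃ i, isValley P i ∧ ht P (i + 1) = h}.Finite := by
    refine ((Set.finite_lt_nat P.length).image fun i => ht P (i + 1)).subset ?_
    rintro _ ⟨j, hj, rfl⟩
    exact ⟨j, hj.1, rfl⟩
  exact (le_csSup hfin.bddAbove ⟨i, hi, rfl⟩).trans (Int.self_le_toNat _)

theorem hvNat_le {P : BinPath} {h : ℕ} (hP : ∀ i, isValley P i → ht P (i + 1) ≤ h) :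
    hvNat P ≤ h := by
  refine Int.toNat_le.2 ?_
  rcases Set.eq_empty_or_nonempty {h : ℤ | ∃ i, isValley P i ∧ ht P (i + 1) = h} with he | he
  · rw [hv, he, Int.csSup_empty]
    exact Int.natCast_nonneg h
  · refine csSup_le he ?_
    rintro _ ⟨i, hi, rfl⟩
    exact hP i hi

/-! ### Multichains of type `V` with a prescribed length -/

/-- A multichain of Dyck paths from `a` to `s` of length `h` (not necessarily the height of the
highest valley of `a`) whose `(j-1)`-st and `j`-th members have the same valleys at every height
at most `h - j`. -/
def IsVChainOfLength (h : ℕ) (a s : BinPath) (σ : ℕ → BinPath) : Prop :=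
  σ 0 = a ∧ (∀ j, h ≤ j → σ j = s) ∧ (∀ j, IsDyck (σ j)) ∧
  (∀ j < h, pathLe (σ j) (σ (j + 1))) ∧
  (∀ j, 1 ≤ j → j ≤ h → sameValleysUpTo (σ (j - 1)) (σ j) ((h : ℤ) - (j : ℤ)))

/-- The number of `a`–`s` multichains of type `V` and of length `h`. -/
noncomputable def vPathOfLength (h : ℕ) (a s : BinPath) : ℕ :=
  Set.ncard {σ : ℕ → BinPath | IsVChainOfLength h a s σ}

theorem vPathOfLength_hvNat (a s : BinPath) : vPathOfLength (hvNat a) a s = VPath a s := rfl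

theorem IsVChainOfLength.length_eq {h : ℕ} {a s : BinPath} {σ : ℕ → BinPath}
    (hσ : IsVChainOfLength h a s σ) (j : ℕ) : (σ j).length = a.length := by
  have hj : ∀ j ≤ h, (σ j).length = a.length := by
    intro j
    induction j with
    | zero => rw [hσ.1]; simp
    | succ j ih => exact fun hj => (hσ.2.2.2.1 j hj).1.symm.trans (ih (by omega))
  rcases le_total j h with h' | h'
  · exact hj j h'
  · rw [hσ.2.1 j h', ← hσ.2.1 h le_rfl, hj h le_rfl]

/-- Once all valleys of `a` have height at most `h`, longer multichains have to start with a
constant step. -/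
theorem vPathOfLength_succ {h : ℕ} {a s : BinPath} (ha : IsDyck a)
    (hh : ∀ i, isValley a i → ht a (i + 1) ≤ h) :
    vPathOfLength (h + 1) a s = vPathOfLength h a s := by
  let f : (ℕ → BinPath) → ℕ → BinPath := fun σ j => Nat.casesOn j a σ
  have hf : Function.Injective f := fun σ τ hστ => funext fun j => congrFun hστ (j + 1)
  rw [vPathOfLength, vPathOfLength, ← Set.ncard_image_of_injective {σ | IsVChainOfLength h a s σ} hf]
  congr 1
  ext σ
  constructor
  · rintro ⟨h₀, hs, hD, hle, hv⟩
    have h₁ : a = σ 1 := by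
      have hle₀ := hle 0 (by omega)
      rw [h₀] at hle₀
      refine hle₀.eq_of_ht_valley_eq fun i hi => ?_
      have := hv 1 le_rfl (by omega) i (ht a (i + 1)) (by simpa using hh i hi)
      rw [Nat.sub_self, h₀] at this
      exact (this.1 ⟨hi, rfl⟩).2
    refine ⟨fun j => σ (j + 1), ⟨h₁.symm, fun j hj => hs _ (by omega), fun j => hD _,
      fun j hj => hle _ (by omega), fun j hj₁ hj => ?_⟩, ?_⟩
    · have := hv (j + 1) (by omega) (by omega)
      rw [Nat.add_sub_cancel] at this
      simpa [Nat.sub_add_cancel hj₁] using this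
    · funext j
      cases j with
      | zero => exact h₀.symm
      | succ j => rfl
  · rintro ⟨τ, ⟨h₀, hs, hD, hle, hv⟩, rfl⟩
    refine ⟨rfl, fun j hj => ?_, fun j => ?_, fun j hj => ?_, fun j hj₁ hj => ?_⟩
    · obtain ⟨j, rfl⟩ := Nat.exists_eq_add_of_le' (Nat.one_le_of_lt hj)
      exact hs j (by omega)
    · cases j with
      | zero => exact ha
      | succ j => exact hD j
    · cases j with
      | zero =>
        change pathLe a (τ 0)
        rw [h₀]
        exact ⟨rfl, fun _ => le_rfl⟩
      | succ j => exact hle j (by omega)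
    · obtain ⟨j, rfl⟩ := Nat.exists_eq_add_of_le' hj₁
      cases j with
      | zero =>
        change sameValleysUpTo a (τ 0) _
        rw [h₀]
        exact fun _ _ _ => Iff.rfl
      | succ j =>
        have := hv (j + 1) (by omega) (by omega)
        simpa [f] using this

theorem vPathOfLength_eq_VPath {h : ℕ} {a s : BinPath} (ha : IsDyck a)
    (hh : ∀ i, isValley a i → ht a (i + 1) ≤ h) : vPathOfLength h a s = VPath a s := by
  induction h, hvNat_le hh using Nat.le_induction with
  | base => rfl
  | succ h hle ih =>
    have hh' : ∀ i, isValley a i → ht a (i + 1) ≤ h := fun i hi =>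
      (ht_le_hvNat hi).trans (by exact_mod_cast hle)
    rw [vPathOfLength_succ ha hh', ih hh']

/-- Members of a multichain of type `V` keep the returns to height `0` of its first member. -/
theorem IsVChainOfLength.ht_eq_zero {h : ℕ} {a b s : BinPath} {σ : ℕ → BinPath}
    (ha : IsDyck a) (hb : IsDyck b) (hσ : IsVChainOfLength h (a ++ b) s σ) (j : ℕ) :
    ht (σ j) a.length = 0 := by
  rcases Nat.eq_zero_or_pos a.length with h₀ | hpos
  · rw [h₀, ht_zero]
  obtain ⟨i, hi⟩ := Nat.exists_eq_add_of_le' hpos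
  have hia : i < a.length := by omega
  have hval : isValley (a ++ b) i ∧ ht (a ++ b) (i + 1) = 0 := by
    have h₀ : ht a (i + 1) = 0 := by rw [← hi]; exact ha.1
    refine ⟨(isValley_append_left hb hia).2 ⟨hia, ?_, List.getD_eq_default _ _ hi.le⟩, ?_⟩
    · have h₁ := ht_succ a hia
      have h₂ := ha.2 i
      split_ifs at h₁ with hd
      · omega
      · simpa using hd
    · rw [ht_append_left _ _ hia, h₀]
  have hj : ∀ j ≤ h, isValley (σ j) i ∧ ht (σ j) (i + 1) = 0 := by
    intro j
    induction j with
    | zero => rw [hσ.1]; exact fun _ => hval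
    | succ j ih =>
      intro hj
      exact (hσ.2.2.2.2 (j + 1) (by omega) hj i 0 (by omega)).1 (ih (by omega))
  rw [hi]
  rcases le_total j h with h' | h'
  · exact (hj j h').2
  · rw [hσ.2.1 j h', ← hσ.2.1 h le_rfl]
    exact (hj h le_rfl).2

theorem vPathOfLength_append {h : ℕ} {a b s t : BinPath} (ha : IsDyck a) (hb : IsDyck b)
    (hlen : a.length = s.length) :
    vPathOfLength h (a ++ b) (s ++ t) = vPathOfLength h a s * vPathOfLength h b t := by
  let f : (ℕ → BinPath) × (ℕ → BinPath) → ℕ → BinPath := fun p j => p.1 j ++ p.2 j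
  have hf : Set.InjOn f
      ({σ | IsVChainOfLength h a s σ} ×ˢ {τ | IsVChainOfLength h b t τ}) := by
    rintro ⟨σ, τ⟩ ⟨hσ, -⟩ ⟨σ', τ'⟩ ⟨hσ', -⟩ heq
    have hj (j : ℕ) : σ j = σ' j ∧ τ j = τ' j :=
      List.append_inj (congrFun heq j) ((hσ.length_eq j).trans (hσ'.length_eq j).symm)
    exact Prod.ext (funext fun j => (hj j).1) (funext fun j => (hj j).2)
  rw [vPathOfLength, vPathOfLength, vPathOfLength, ← Set.ncard_prod, ← hf.ncard_image]
  congr 1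
  ext ρ
  constructor
  · intro hρ
    have hl (j : ℕ) : ((ρ j).take a.length).length = a.length := by
      simp [hρ.length_eq j]
    have hρj (j : ℕ) : (ρ j).take a.length ++ (ρ j).drop a.length = ρ j :=
      List.take_append_drop _ _
    have hD (j : ℕ) : IsDyck ((ρ j).take a.length) ∧ IsDyck ((ρ j).drop a.length) := by
      refine IsDyck.of_append ?_ ?_
      · rw [hρj]
        exact hρ.2.2.1 j
      · rw [hρj, hl]
        exact hρ.ht_eq_zero ha hb j
    have hle (j : ℕ) (hj : j < h) :=
      (pathLe_append_iff ((hl j).trans (hl (j + 1)).symm) (hD j).1 (hD (j + 1)).1).1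
        ((hρj j).symm ▸ (hρj (j + 1)).symm ▸ hρ.2.2.2.1 j hj)
    have hv (j : ℕ) (hj₁ : 1 ≤ j) (hj : j ≤ h) :=
      (sameValleysUpTo_append_iff ((hl (j - 1)).trans (hl j).symm) (hD (j - 1)).1 (hD (j - 1)).2
        (hD j).1 (hD j).2 _).1 ((hρj (j - 1)).symm ▸ (hρj j).symm ▸ hρ.2.2.2.2 j hj₁ hj)
    refine ⟨(fun j => (ρ j).take a.length, fun j => (ρ j).drop a.length), ⟨?_, ?_⟩, funext hρj⟩
    · exact ⟨by simp [hρ.1], fun j hj => by simp [hρ.2.1 j hj, hlen], fun j => (hD j).1,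
        fun j hj => (hle j hj).1, fun j hj₁ hj => (hv j hj₁ hj).1⟩
    · exact ⟨by simp [hρ.1], fun j hj => by simp [hρ.2.1 j hj, hlen], fun j => (hD j).2,
        fun j hj => (hle j hj).2, fun j hj₁ hj => (hv j hj₁ hj).2⟩
  · rintro ⟨⟨σ, τ⟩, ⟨hσ, hτ⟩, rfl⟩
    have hl (i j : ℕ) : (σ i).length = (σ j).length :=
      (hσ.length_eq i).trans (hσ.length_eq j).symm
    obtain ⟨hσ₀, hσs, hσD, hσle, hσv⟩ := hσ
    obtain ⟨hτ₀, hτs, hτD, hτle, hτv⟩ := hτ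
    exact ⟨congrArg₂ _ hσ₀ hτ₀, fun j hj => congrArg₂ _ (hσs j hj) (hτs j hj),
      fun j => (hσD j).append (hτD j),
      fun j hj => (pathLe_append_iff (hl _ _) (hσD _) (hσD _)).2 ⟨hσle j hj, hτle j hj⟩,
      fun j hj₁ hj => (sameValleysUpTo_append_iff (hl _ _) (hσD _) (hτD _) (hσD _) (hτD _) _).2
        ⟨hσv j hj₁ hj, hτv j hj₁ hj⟩⟩

theorem isDyck_flatten_ofFn {k : ℕ} {a : Fin k → BinPath} (ha : ∀ i, IsDyck (a i)) :
    IsDyck (List.ofFn a).flatten := by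
  induction k with
  | zero => simpa using isDyck_nil
  | succ k ih =>
    rw [List.ofFn_succ, List.flatten_cons]
    exact (ha 0).append (ih fun i => ha i.succ)

theorem vPathOfLength_nil (h : ℕ) : vPathOfLength h [] [] = 1 := by
  rw [vPathOfLength, Set.ncard_eq_one]
  refine ⟨fun _ => [], Set.eq_singleton_iff_unique_mem.2 ⟨?_, fun σ hσ => ?_⟩⟩
  · exact ⟨rfl, fun _ _ => rfl, fun _ => isDyck_nil, fun _ _ => ⟨rfl, fun _ => le_rfl⟩,
      fun _ _ _ _ _ _ => Iff.rfl⟩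
  · exact funext fun j => List.length_eq_zero_iff.1 (hσ.length_eq j)

/-- Type-`V` multichains between concatenations of Dyck paths are counted factor by factor. -/
theorem vPathOfLength_flatten_ofFn {h k : ℕ} {a s : Fin k → BinPath}
    (ha : ∀ i, IsDyck (a i)) (hlen : ∀ i, (a i).length = (s i).length)
    (hh : ∀ i, isValley (List.ofFn a).flatten i → ht (List.ofFn a).flatten (i + 1) ≤ h) :
    vPathOfLength h (List.ofFn a).flatten (List.ofFn s).flatten = ∏ i, VPath (a i) (s i) := by
  induction k with
  | zero => simpa using vPathOfLength_nil h
  | succ k ih =>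
    have hD := isDyck_flatten_ofFn fun i : Fin k => ha i.succ
    simp only [List.ofFn_succ, List.flatten_cons] at hh ⊢
    rw [vPathOfLength_append (ha 0) hD (hlen 0), Fin.prod_univ_succ,
      vPathOfLength_eq_VPath (ha 0), ih (fun i => ha i.succ) (fun i => hlen i.succ)]
    · intro i hi
      have := hh _ ((isValley_append_right _ _ i).2 hi)
      rwa [add_assoc, ht_append_right, (ha 0).1, zero_add] at this
    · intro i hi
      have := hh i ((isValley_append_left hD hi.1).2 hi)
      rwa [ht_append_left _ _ hi.1] at this

/-- For Dyck paths `aᵢ ≤ sᵢ` of equal lengths,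
`V(ua₁d⋯ua_kd, us₁d⋯us_kd) = Π V(uaᵢd, usᵢd)`. -/
theorem statement13 (k : ℕ) (a s : Fin k → BinPath)
    (ha : ∀ i, IsDyck (a i)) (hs : ∀ i, IsDyck (s i))
    (hlen : ∀ i, (a i).length = (s i).length)
    (hle : ∀ i, pathLe (a i) (s i)) :
    VPath ((List.ofFn fun i => true :: (a i ++ [false])).flatten)
        ((List.ofFn fun i => true :: (s i ++ [false])).flatten)
      = ∏ i, VPath (true :: (a i ++ [false])) (true :: (s i ++ [false])) := by
  rw [← vPathOfLength_hvNat]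
  exact vPathOfLength_flatten_ofFn (fun i => (ha i).elevate) (fun i => by simp [hlen i])
    fun i hi => ht_le_hvNat hi
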